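/- Let G be a Θ4-graph (a subdivision of K_4) of order n ≥ 29. Then Sz*(G) < (n³ + 2n² − 18)/4. -/

import Mathlib

attribute [local instance] Classical.propDecidable

noncomputable def nC {V : Type*} [Fintype V] (G : SimpleGraph V) (u v : V) : ℕ :=
  (Finset.univ.filter fun w => G.dist u w < G.dist v w).card

noncomputable def nE {V : Type*} [Fintype V] (G : SimpleGraph V) (u v : V) : ℕ :=
  (Finset.univ.filter fun w => G.dist u w = G.dist v w).card

lemma nE_comm {V : Type*} [Fintype V] (G : SimpleGraph V) (u v : V) :
    nE G u v = nE G v u := by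
  unfold nE; congr 1; ext w; simp [eq_comm]

noncomputable def szContrib {V : Type*} [Fintype V] (G : SimpleGraph V) : Sym2 V → ℚ :=
  Sym2.lift ⟨fun u v =>
    ((nC G u v : ℚ) + (nE G u v : ℚ) / 2) * ((nC G v u : ℚ) + (nE G u v : ℚ) / 2),
    fun u v => by dsimp only; rw [nE_comm]; ring⟩

noncomputable def revSz {V : Type*} [Fintype V] (G : SimpleGraph V) : ℚ :=
  ∑ e ∈ G.edgeFinset, szContrib G e
/-- Two paths are internally disjoint if every common vertex is an endpoint of both. -/
def IntDisj {V : Type*} {G : SimpleGraph V} {x y x' y' : V}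
    (P : G.Walk x y) (Q : G.Walk x' y') : Prop :=
  ∀ v : V, v ∈ P.support → v ∈ Q.support → (v = x ∨ v = y) ∧ (v = x' ∨ v = y')
/-- `G` is a Θ₄-graph: a subdivision of `K₄`, consisting of four distinct vertices
`w, x, y, z` joined pairwise by six pairwise internally disjoint paths, every vertex
and every edge of `G` lying on one of these paths. -/
def IsTheta4 {V : Type*} (G : SimpleGraph V) : Prop :=
  ∃ (w x y z : V) (Pwx : G.Walk w x) (Pwy : G.Walk w y) (Pwz : G.Walk w z)
    (Pxy : G.Walk x y) (Pxz : G.Walk x z) (Pyz : G.Walk y z),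
    w ≠ x ∧ w ≠ y ∧ w ≠ z ∧ x ≠ y ∧ x ≠ z ∧ y ≠ z ∧
    Pwx.IsPath ∧ Pwy.IsPath ∧ Pwz.IsPath ∧ Pxy.IsPath ∧ Pxz.IsPath ∧ Pyz.IsPath ∧
    IntDisj Pwx Pwy ∧ IntDisj Pwx Pwz ∧ IntDisj Pwx Pxy ∧ IntDisj Pwx Pxz ∧
    IntDisj Pwx Pyz ∧ IntDisj Pwy Pwz ∧ IntDisj Pwy Pxy ∧ IntDisj Pwy Pxz ∧
    IntDisj Pwy Pyz ∧ IntDisj Pwz Pxy ∧ IntDisj Pwz Pxz ∧ IntDisj Pwz Pyz ∧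
    IntDisj Pxy Pxz ∧ IntDisj Pxy Pyz ∧ IntDisj Pxz Pyz ∧
    (∀ v : V, v ∈ Pwx.support ∨ v ∈ Pwy.support ∨ v ∈ Pwz.support ∨
      v ∈ Pxy.support ∨ v ∈ Pxz.support ∨ v ∈ Pyz.support) ∧
    (∀ e ∈ G.edgeSet, e ∈ Pwx.edges ∨ e ∈ Pwy.edges ∨ e ∈ Pwz.edges ∨
      e ∈ Pxy.edges ∨ e ∈ Pxz.edges ∨ e ∈ Pyz.edges)

/-- The transmission of `v`: the sum of the distances from `v` to all vertices. -/
noncomputable def transmission {V : Type*} [Fintype V] (G : SimpleGraph V) (v : V) : ℤ :=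
  ∑ u, (G.dist v u : ℤ)

lemma nC_add_nC_add_nE {V : Type*} [Fintype V] (G : SimpleGraph V) (u v : V) :
    nC G u v + nC G v u + nE G u v = Fintype.card V := by
  unfold nC nE
  rw [Finset.card_filter, Finset.card_filter, Finset.card_filter, ← Finset.sum_add_distrib,
    ← Finset.sum_add_distrib, ← Finset.card_univ, Finset.card_eq_sum_ones]
  refine Finset.sum_congr rfl fun w _ => ?_
  split_ifs <;> omega

lemma dist_cases_of_adj {V : Type*} {G : SimpleGraph V} {u v : V} (h : G.Adj u v) (w : V) :
    G.dist u w = G.dist v w ∨ G.dist u w = G.dist v w + 1 ∨ G.dist u w + 1 = G.dist v w := by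
  have := h.diff_dist_adj (u := w)
  rw [G.dist_comm (u := u), G.dist_comm (u := v)]
  omega

lemma transmission_sub_of_adj {V : Type*} [Fintype V] {G : SimpleGraph V} {u v : V}
    (h : G.Adj u v) : transmission G u - transmission G v = nC G v u - nC G u v := by
  unfold nC transmission
  rw [Finset.card_filter, Finset.card_filter]
  push_cast
  rw [← Finset.sum_sub_distrib, ← Finset.sum_sub_distrib]
  refine Finset.sum_congr rfl fun w _ => ?_
  have := dist_cases_of_adj h w
  split_ifs <;> omega

/-- The square of the difference of the transmissions of the endpoints. -/
noncomputable def transmissionDiffSq {V : Type*} [Fintype V] (G : SimpleGraph V) : Sym2 V → ℤ :=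
  Sym2.lift ⟨fun u v => (transmission G u - transmission G v) ^ 2, fun u v => by ring⟩

lemma transmissionDiffSq_nonneg {V : Type*} [Fintype V] (G : SimpleGraph V) (e : Sym2 V) :
    0 ≤ transmissionDiffSq G e := by
  induction e with
  | _ u v => exact sq_nonneg (transmission G u - transmission G v)

lemma szContrib_eq {V : Type*} [Fintype V] {G : SimpleGraph V} {e : Sym2 V}
    (he : e ∈ G.edgeSet) :
    szContrib G e = ((Fintype.card V : ℚ) ^ 2 - transmissionDiffSq G e) / 4 := by
  induction e with
  | _ u v =>
    have h1 : (transmission G u - transmission G v : ℚ) = nC G v u - nC G u v := by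
      exact_mod_cast transmission_sub_of_adj (G.mem_edgeSet.1 he)
    have h2 : (nC G u v + nC G v u + nE G u v : ℚ) = Fintype.card V := by
      exact_mod_cast nC_add_nC_add_nE G u v
    simp only [szContrib, transmissionDiffSq, Sym2.lift_mk]
    push_cast
    rw [h1, ← h2]
    ring

lemma revSz_eq {V : Type*} [Fintype V] (G : SimpleGraph V) :
    revSz G = (G.edgeFinset.card * (Fintype.card V : ℚ) ^ 2
      - (∑ e ∈ G.edgeFinset, transmissionDiffSq G e : ℤ)) / 4 := by
  unfold revSz
  rw [Finset.sum_congr rfl fun e he => szContrib_eq (SimpleGraph.mem_edgeFinset.1 he),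
    ← Finset.sum_div, Finset.sum_sub_distrib]
  simp

lemma le_dist_of_lipschitz {V : Type*} {G : SimpleGraph V} (hc : G.Connected) (f : V → ℤ)
    (hf : ∀ u v, G.Adj u v → f v ≤ f u + 1) (a u : V) : f u ≤ f a + G.dist a u := by
  obtain ⟨p, hp⟩ := hc.exists_walk_length_eq_dist a u
  rw [← hp]
  clear hp
  induction p with
  | nil => simp
  | cons h p ih =>
    have := hf _ _ h
    rw [SimpleGraph.Walk.length_cons]
    push_cast
    omega

/-- `P` is an ear of `G`: the internal vertices of `P` only meet edges of `P`. -/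
def IsEar {V : Type*} {G : SimpleGraph V} {w x : V} (P : G.Walk w x) : Prop :=
  ∀ u v : V, G.Adj u v → s(u, v) ∈ P.edges ∨
    ∀ t ∈ P.support, t = u ∨ t = v → t = w ∨ t = x

lemma exists_getVert_of_mem_edges {V : Type*} {G : SimpleGraph V} {w x u v : V}
    {P : G.Walk w x} (h : s(u, v) ∈ P.edges) :
    ∃ i < P.length, u = P.getVert i ∧ v = P.getVert (i + 1) ∨
      v = P.getVert i ∧ u = P.getVert (i + 1) := by
  rw [← P.mem_edges_toSubgraph, SimpleGraph.Subgraph.mem_edgeSet, P.toSubgraph_adj_iff] at h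
  obtain ⟨i, hi, hl⟩ := h
  refine ⟨i, hl, ?_⟩
  rw [Sym2.eq_iff] at hi
  aesop

lemma getVert_eq_iff {V : Type*} {G : SimpleGraph V} {w x : V} {P : G.Walk w x}
    (hP : P.IsPath) {i j : ℕ} (hi : i ≤ P.length) (hj : j ≤ P.length) :
    P.getVert i = P.getVert j ↔ i = j :=
  ⟨fun h => hP.getVert_injOn hi hj h, fun h => h ▸ rfl⟩

/-- Lower bounds for the distances from the `k`-th vertex of an ear. -/
lemma le_dist_getVert {V : Type*} {G : SimpleGraph V} (hc : G.Connected) {w x : V}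
    {P : G.Walk w x} (hP : P.IsPath) (hE : IsEar P) {k : ℕ} (hk : k ≤ P.length) :
    (∀ u, (u ∈ P.support → u = w ∨ u = x) →
      min ((G.dist w u : ℤ) + k) (G.dist x u + P.length - k) ≤ G.dist (P.getVert k) u) ∧
    ∀ i ≤ P.length, min (max ((i : ℤ) - k) (k - i)) (min (i + G.dist w x + P.length - k)
      (P.length - i + G.dist w x + k)) ≤ G.dist (P.getVert k) (P.getVert i) := by
  have hD : G.dist w x ≤ P.length := G.dist_le P
  have hD' : G.dist x w = G.dist w x := G.dist_comm
  set L := P.length with hL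
  set D := G.dist w x with hDdef
  obtain ⟨ψ, hψ⟩ : ∃ ψ : ℕ → ℤ, ∀ i, ψ i = min (max ((i : ℤ) - k) (k - i)) (min (i + D + L - k) (L - i + D + k)) :=
    ⟨_, fun _ => rfl⟩
  obtain ⟨o, ho⟩ : ∃ o : V → ℤ, ∀ v, o v = min ((G.dist w v : ℤ) + k) (G.dist x v + L - k) :=
    ⟨_, fun _ => rfl⟩
  obtain ⟨f, hf⟩ : ∃ f : V → ℤ, ∀ v, f v =
    if h : ∃ i, i ≤ L ∧ P.getVert i = v then ψ h.choose else o v := ⟨_, fun _ => rfl⟩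
  have hfi : ∀ i ≤ L, f (P.getVert i) = ψ i := by
    intro i hi
    have h : ∃ j, j ≤ L ∧ P.getVert j = P.getVert i := ⟨i, hi, rfl⟩
    rw [hf, dif_pos h, (getVert_eq_iff hP h.choose_spec.1 hi).1 h.choose_spec.2]
  have hfo : ∀ u, (u ∈ P.support → u = w ∨ u = x) → f u = o u := by
    intro u hu
    by_cases h : ∃ i, i ≤ L ∧ P.getVert i = u
    · obtain ⟨i, hi, rfl⟩ := h
      rcases hu (P.getVert_mem_support i) with h | h
      · have h0 := hfi 0 (Nat.zero_le _)
        rw [P.getVert_zero] at h0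
        rw [h, h0, hψ, ho, G.dist_self, hD']
        omega
      · have h0 := hfi L le_rfl
        rw [hL, P.getVert_length] at h0
        rw [h, h0, hψ, ho, G.dist_self]
        omega
    · rw [hf, dif_neg h]
  have key := le_dist_of_lipschitz hc f ?_ (P.getVert k)
  · have hk0 : f (P.getVert k) = 0 := by
      rw [hfi k hk, hψ]
      omega
    simp only [hk0, zero_add] at key
    refine ⟨fun u hu => ?_, fun i hi => ?_⟩
    · rw [← ho, ← hfo u hu]
      exact key u
    · rw [← hψ, ← hfi i hi]
      exact key _
  · intro u v huv
    rcases hE u v huv with h | h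
    · obtain ⟨i, hi, ⟨rfl, rfl⟩ | ⟨rfl, rfl⟩⟩ := exists_getVert_of_mem_edges h <;>
      · rw [hfi i hi.le, hfi (i + 1) hi, hψ, hψ]
        push_cast
        omega
    · rw [hfo u fun hu => h u hu (Or.inl rfl), hfo v fun hv => h v hv (Or.inr rfl), ho, ho]
      have h1 := dist_cases_of_adj huv w
      have h2 := dist_cases_of_adj huv x
      rw [G.dist_comm (u := w), G.dist_comm (u := x), G.dist_comm (u := w), G.dist_comm (u := x)]
      omega

lemma dist_getVert_getVert_le {V : Type*} {G : SimpleGraph V} (hc : G.Connected) {w x : V}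
    (P : G.Walk w x) {i j : ℕ} (hij : i ≤ j) (hj : j ≤ P.length) :
    G.dist (P.getVert i) (P.getVert j) ≤ j - i := by
  induction j, hij using Nat.le_induction with
  | base => simp
  | succ j hij ih =>
    have h1 := hc.dist_triangle (u := P.getVert i) (v := P.getVert j) (w := P.getVert (j + 1))
    have h2 := SimpleGraph.dist_eq_one_iff_adj.2 (P.adj_getVert_succ (i := j) (by omega))
    have := ih (by omega)
    omega

/-- If the endpoints of an ear are joined by a shortcut, the transmission increases along the
beginning of the ear. -/
lemma le_transmission_getVert_sub {V : Type*} [Fintype V] {G : SimpleGraph V} (hc : G.Connected)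
    {w x : V} {P : G.Walk w x} (hP : P.IsPath) (hE : IsEar P) {k : ℕ}
    (hk : 2 * k + G.dist w x ≤ P.length) :
    (k : ℤ) * (Fintype.card V - P.length - G.dist w x) ≤
      transmission G (P.getVert k) - transmission G w := by
  obtain ⟨m, hm⟩ : ∃ m, P.length = k + m := ⟨P.length - k, by omega⟩
  obtain ⟨hout, hin⟩ := le_dist_getVert hc hP hE (k := k) (by omega)
  set S : Finset V := (Finset.range P.length).image P.getVert with hS
  have hinj : Set.InjOn P.getVert (Finset.range P.length) := by
    intro i hi j hj h
    simp only [Finset.coe_range, Set.mem_Iio] at hi hj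
    exact (getVert_eq_iff hP hi.le hj.le).1 h
  have hScard : S.card = P.length := by
    rw [hS, Finset.card_image_of_injOn hinj, Finset.card_range]
  have hfar : ∀ i ≤ P.length, (G.dist w (P.getVert i) : ℤ) ≤ min (i : ℤ)
      (G.dist w x + P.length - i) := by
    intro i hi
    have h1 := dist_getVert_getVert_le hc P (Nat.zero_le i) hi
    have h2 := dist_getVert_getVert_le hc P hi le_rfl
    have h3 := hc.dist_triangle (u := w) (v := x) (w := P.getVert i)
    rw [P.getVert_zero] at h1
    rw [P.getVert_length, G.dist_comm] at h2
    omega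
  have hsumS : -(k * G.dist w x : ℤ) ≤
      ∑ u ∈ S, ((G.dist (P.getVert k) u : ℤ) - G.dist w u) := by
    rw [hS, Finset.sum_image hinj, Finset.sum_sub_distrib]
    have h1 : ∑ i ∈ Finset.range k, ((k : ℤ) - i) +
        ∑ j ∈ Finset.range m, min (j : ℤ) (G.dist w x + P.length - j) ≤
        ∑ i ∈ Finset.range P.length, (G.dist (P.getVert k) (P.getVert i) : ℤ) := by
      rw [hm, Finset.sum_range_add, ← hm]
      refine add_le_add (Finset.sum_le_sum fun i hi => ?_) (Finset.sum_le_sum fun j hj => ?_)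
      · have := hin i (by simp at hi; omega)
        simp at hi
        omega
      · have := hin (k + j) (by simp at hj; omega)
        push_cast at this
        omega
    have h2 : ∑ i ∈ Finset.range P.length, (G.dist w (P.getVert i) : ℤ) ≤
        ∑ j ∈ Finset.range m, min (j : ℤ) (G.dist w x + P.length - j) +
        ∑ i ∈ Finset.range k, ((k : ℤ) - i + G.dist w x) := by
      rw [hm, add_comm k m, Finset.sum_range_add, add_comm m k, ← hm]
      refine add_le_add (Finset.sum_le_sum fun i hi => ?_) (Finset.sum_le_sum fun j hj => ?_)
      · exact hfar i (by simp at hi; omega)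
      · have := hfar (m + j) (by simp at hj; omega)
        push_cast at this
        omega
    rw [Finset.sum_add_distrib, Finset.sum_const, Finset.card_range, nsmul_eq_mul] at h2
    linarith
  have hsumO : (k : ℤ) * (Fintype.card V - P.length) ≤
      ∑ u ∈ Sᶜ, ((G.dist (P.getVert k) u : ℤ) - G.dist w u) := by
    have hcard : ((Sᶜ.card : ℕ) : ℤ) = Fintype.card V - P.length := by
      have := S.card_compl_add_card
      omega
    rw [← hcard, mul_comm, ← nsmul_eq_mul]
    refine Finset.card_nsmul_le_sum _ _ _ fun u hu => ?_
    have hu' := hout u fun hu' => by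
      obtain ⟨i, rfl, hi⟩ := SimpleGraph.Walk.mem_support_iff_exists_getVert.1 hu'
      rcases hi.lt_or_eq with hi | rfl
      · simp only [hS, Finset.mem_compl, Finset.mem_image, Finset.mem_range, not_exists] at hu
        exact absurd ⟨hi, rfl⟩ (hu i)
      · exact Or.inr P.getVert_length
    have h3 := hc.dist_triangle (u := w) (v := x) (w := u)
    omega
  unfold transmission
  rw [← Finset.sum_sub_distrib, ← Finset.sum_add_sum_compl S]
  linarith

lemma IsEar.reverse {V : Type*} {G : SimpleGraph V} {w x : V} {P : G.Walk w x} (hE : IsEar P) :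
    IsEar P.reverse := by
  intro u v h
  have := hE u v h
  simp only [SimpleGraph.Walk.edges_reverse, SimpleGraph.Walk.support_reverse, List.mem_reverse]
  exact this.imp id fun h t ht htu => (h t ht htu).symm

lemma le_two_mul_sum_support {V : Type*} {G : SimpleGraph V} {L : ℤ} (hL : 2 ≤ L) (t : V → ℤ)
    (ht : ∀ a, -L ≤ t a ∧ t a ≤ L) (hadj : ∀ a b, G.Adj a b → t a ≤ t b + 2 ∧ t b ≤ t a + 2)
    {u v : V} (Q : G.Walk u v) :
    (min 1 (t u + L - 1) + min 1 (L - 1 - t u)) + (min 1 (t v + L - 1) + min 1 (L - 1 - t v)) +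
      (t u + max (-(L - 2)) (min (t u) (L - 2))) - (t v + max (-(L - 2)) (min (t v) (L - 2))) ≤
    2 * (Q.support.map fun a => min 1 (t a + L - 1) + min 1 (L - 1 - t a)).sum := by
  induction Q with
  | nil => simp; omega
  | @cons a b c h Q ih =>
    simp only [SimpleGraph.Walk.support_cons, List.map_cons, List.sum_cons]
    have := hadj a b h
    have := ht a
    have := ht b
    omega

/-- If the endpoints of an ear `P` are joined by two further disjoint paths and have distance at
least `P.length - 1`, then the transmission increases at the ends of the ear. -/
lemma le_transmission_ends {V : Type*} [Fintype V] {G : SimpleGraph V} (hc : G.Connected)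
    {w x : V} {P Q R : G.Walk w x} (hP : P.IsPath) (hE : IsEar P) (hQ : Q.IsPath) (hR : R.IsPath)
    (hPQ : ∀ v ∈ P.support, v ∈ Q.support → v = w ∨ v = x)
    (hPR : ∀ v ∈ P.support, v ∈ R.support → v = w ∨ v = x)
    (hQR : ∀ v ∈ Q.support, v ∈ R.support → v = w ∨ v = x)
    (hL : 2 ≤ P.length) (hD : P.length ≤ G.dist w x + 1) :
    2 * (P.length : ℤ) - 4 ≤ (transmission G (P.getVert 1) - transmission G w) +
      (transmission G (P.getVert (P.length - 1)) - transmission G x) := by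
  obtain ⟨t, ht⟩ : ∃ t : V → ℤ, ∀ v, t v = (G.dist x v : ℤ) - G.dist w v := ⟨_, fun _ => rfl⟩
  obtain ⟨c, hcd⟩ : ∃ c : V → ℤ, ∀ v, c v =
    min 1 (t v + P.length - 1) + min 1 (P.length - 1 - t v) := ⟨_, fun _ => rfl⟩
  have hDL : G.dist w x ≤ P.length := G.dist_le P
  have hcomm : G.dist x w = G.dist w x := G.dist_comm
  have htb : ∀ v, -(P.length : ℤ) ≤ t v ∧ t v ≤ P.length := by
    intro v
    have h1 := hc.dist_triangle (u := w) (v := x) (w := v)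
    have h2 := hc.dist_triangle (u := x) (v := w) (w := v)
    rw [ht]
    omega
  have htw : t w = G.dist w x := by rw [ht, G.dist_self, hcomm]; simp
  have htx : t x = -G.dist w x := by rw [ht, G.dist_self]; simp
  have htadj : ∀ a b, G.Adj a b → t a ≤ t b + 2 ∧ t b ≤ t a + 2 := by
    intro a b hab
    have h1 := dist_cases_of_adj hab w
    have h2 := dist_cases_of_adj hab x
    rw [ht, ht, G.dist_comm (u := w), G.dist_comm (u := x), G.dist_comm (u := w),
      G.dist_comm (u := x)]
    omega
  have hc0 : ∀ v, 0 ≤ c v := by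
    intro v
    have := htb v
    rw [hcd]
    omega
  have hsupp : ∀ {Q : G.Walk w x}, Q.IsPath →
      2 * (P.length - 1 : ℤ) ≤ ∑ v ∈ Q.support.toFinset, c v := by
    intro Q hQ
    have h := le_two_mul_sum_support (by omega : (2 : ℤ) ≤ P.length) t htb htadj Q
    rw [List.sum_toFinset _ hQ.support_nodup]
    simp only [← hcd] at h
    rw [hcd, hcd, htw, htx] at h
    omega
  set I : Finset V := (Finset.Ioo 0 P.length).image P.getVert with hI
  have hIcard : (I.card : ℤ) = P.length - 1 := by
    rw [hI, Finset.card_image_of_injOn, Nat.card_Ioo]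
    · omega
    · intro i hi j hj h
      simp only [Finset.coe_Ioo, Set.mem_Ioo] at hi hj
      exact (getVert_eq_iff hP hi.2.le hj.2.le).1 h
  have hnotI : ∀ u, u ∉ I → u ∈ P.support → u = w ∨ u = x := by
    intro u hu hu'
    obtain ⟨i, rfl, hi⟩ := SimpleGraph.Walk.mem_support_iff_exists_getVert.1 hu'
    simp only [hI, Finset.mem_image, Finset.mem_Ioo, not_exists, not_and] at hu
    have hi' : i = 0 ∨ i = P.length := by
      by_contra hne
      exact hu i (by omega) rfl
    rcases hi' with rfl | rfl
    · exact Or.inl P.getVert_zero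
    · exact Or.inr P.getVert_length
  have hIspec : ∀ u ∈ I, u ∈ P.support ∧ u ≠ w ∧ u ≠ x := by
    intro u hu
    simp only [hI, Finset.mem_image, Finset.mem_Ioo] at hu
    obtain ⟨i, hi, rfl⟩ := hu
    refine ⟨P.getVert_mem_support i, fun h => ?_, fun h => ?_⟩
    · have := (getVert_eq_iff hP hi.2.le (Nat.zero_le _)).1 (h.trans P.getVert_zero.symm)
      omega
    · have := (getVert_eq_iff hP hi.2.le le_rfl).1 (h.trans P.getVert_length.symm)
      omega
  have hsumO : 4 * (P.length - 1 : ℤ) - 2 ≤ ∑ u ∈ Iᶜ, c u := by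
    have h1 : ∑ u ∈ Q.support.toFinset ∪ R.support.toFinset, c u ≤ ∑ u ∈ Iᶜ, c u := by
      refine Finset.sum_le_sum_of_subset_of_nonneg (fun u hu => ?_) fun u _ _ => hc0 u
      rw [Finset.mem_compl]
      intro huI
      obtain ⟨h1, h2, h3⟩ := hIspec u huI
      simp only [Finset.mem_union, List.mem_toFinset] at hu
      rcases hu with hu | hu
      · exact (hPQ u h1 hu).elim h2 h3
      · exact (hPR u h1 hu).elim h2 h3
    have h2 : ∑ u ∈ Q.support.toFinset ∩ R.support.toFinset, c u ≤ ∑ u ∈ ({w, x} : Finset V), c u := by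
      refine Finset.sum_le_sum_of_subset_of_nonneg (fun u hu => ?_) fun u _ _ => hc0 u
      simp only [Finset.mem_inter, List.mem_toFinset] at hu
      simpa using hQR u hu.1 hu.2
    have hwx : w ≠ x := by
      rintro rfl
      rw [G.dist_self] at hD
      omega
    rw [Finset.sum_pair hwx, hcd, hcd, htw, htx] at h2
    have h3 := Finset.sum_union_inter (s₁ := Q.support.toFinset) (s₂ := R.support.toFinset) (f := c)
    have h4 := hsupp hQ
    have h5 := hsupp hR
    omega
  obtain ⟨hout1, -⟩ := le_dist_getVert hc hP hE (k := 1) (by omega)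
  obtain ⟨hout2, -⟩ := le_dist_getVert hc hP hE (k := P.length - 1) (by omega)
  have hstart := SimpleGraph.Walk.adj_getVert_succ P (i := 0) (by omega)
  have hend := SimpleGraph.Walk.adj_getVert_succ P (i := P.length - 1) (by omega)
  rw [P.getVert_zero, zero_add] at hstart
  rw [show P.length - 1 + 1 = P.length by omega, P.getVert_length] at hend
  unfold transmission
  rw [← Finset.sum_sub_distrib, ← Finset.sum_sub_distrib, ← Finset.sum_add_distrib,
    ← Finset.sum_add_sum_compl I]
  have hin : (I.card : ℤ) * (-2) ≤ ∑ u ∈ I, (((G.dist (P.getVert 1) u : ℤ) - G.dist w u) +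
      ((G.dist (P.getVert (P.length - 1)) u : ℤ) - G.dist x u)) := by
    rw [← nsmul_eq_mul]
    refine Finset.card_nsmul_le_sum _ _ _ fun u _ => ?_
    have h1 := dist_cases_of_adj hstart u
    have h2 := dist_cases_of_adj hend u
    omega
  have hout : ∑ u ∈ Iᶜ, c u ≤ ∑ u ∈ Iᶜ, (((G.dist (P.getVert 1) u : ℤ) - G.dist w u) +
      ((G.dist (P.getVert (P.length - 1)) u : ℤ) - G.dist x u)) := by
    refine Finset.sum_le_sum fun u hu => ?_
    have h1 := hout1 u (hnotI u (Finset.mem_compl.1 hu))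
    have h2 := hout2 u (hnotI u (Finset.mem_compl.1 hu))
    rw [hcd, ht]
    omega
  rw [hIcard] at hin
  linarith

lemma length_add_length_add_length_le {V : Type*} [Fintype V] {G : SimpleGraph V}
    {w x : V} {P Q R : G.Walk w x} (hP : P.IsPath) (hQ : Q.IsPath) (hR : R.IsPath)
    (hPQ : ∀ v ∈ P.support, v ∈ Q.support → v = w ∨ v = x)
    (hPR : ∀ v ∈ P.support, v ∈ R.support → v = w ∨ v = x)
    (hQR : ∀ v ∈ Q.support, v ∈ R.support → v = w ∨ v = x) :
    P.length + Q.length + R.length ≤ Fintype.card V + 1 := by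
  have hcard : ∀ {Q : G.Walk w x}, Q.IsPath → Q.support.toFinset.card = Q.length + 1 := by
    intro Q hQ
    rw [List.toFinset_card_of_nodup hQ.support_nodup, Q.length_support]
  have h1 := Finset.card_union_add_card_inter P.support.toFinset Q.support.toFinset
  have h2 := Finset.card_union_add_card_inter (P.support.toFinset ∪ Q.support.toFinset)
    R.support.toFinset
  have h3 : (P.support.toFinset ∩ Q.support.toFinset).card ≤ 2 := by
    refine (Finset.card_le_card fun v hv => ?_).trans (Finset.card_le_two (a := w) (b := x))
    simp only [Finset.mem_inter, List.mem_toFinset] at hv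
    simpa using hPQ v hv.1 hv.2
  have h4 : ((P.support.toFinset ∪ Q.support.toFinset) ∩ R.support.toFinset).card ≤ 2 := by
    refine (Finset.card_le_card fun v hv => ?_).trans (Finset.card_le_two (a := w) (b := x))
    simp only [Finset.mem_inter, Finset.mem_union, List.mem_toFinset] at hv
    simpa using hv.1.elim (fun h => hPR v h hv.2) fun h => hQR v h hv.2
  have h5 := ((P.support.toFinset ∪ Q.support.toFinset) ∪ R.support.toFinset).card_le_univ
  rw [hcard hP, hcard hQ] at h1
  rw [hcard hR] at h2
  omega

lemma le_sum_range_sq_sub_of_ends (T : ℕ → ℤ) {L : ℕ} (hL : 2 ≤ L)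
    (h : 7 ≤ (T 1 - T 0) + (T (L - 1) - T L)) :
    19 ≤ ∑ i ∈ Finset.range L, (T (i + 1) - T i) ^ 2 := by
  have hsub : ({0, L - 1} : Finset ℕ) ⊆ Finset.range L := by
    intro i hi
    simp only [Finset.mem_insert, Finset.mem_singleton] at hi
    simp only [Finset.mem_range]
    omega
  refine le_trans ?_ (Finset.sum_le_sum_of_subset_of_nonneg hsub fun _ _ _ => sq_nonneg _)
  rw [Finset.sum_pair (by omega), show L - 1 + 1 = L by omega, zero_add]
  nlinarith [sq_nonneg ((T 1 - T 0) - (T (L - 1) - T L))]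

lemma sub_add_sub_le_sum_range_sq_sub (T : ℕ → ℤ) {k L : ℕ} (hk : 2 * k ≤ L) :
    (T k - T 0) + (T (L - k) - T L) ≤ ∑ i ∈ Finset.range L, (T (i + 1) - T i) ^ 2 := by
  obtain ⟨m, rfl⟩ : ∃ m, L = k + m + k := ⟨L - 2 * k, by omega⟩
  rw [Finset.sum_range_add, Finset.sum_range_add, Nat.add_sub_cancel]
  have h1 : T k - T 0 ≤ ∑ i ∈ Finset.range k, (T (i + 1) - T i) ^ 2 := by
    rw [← Finset.sum_range_sub]
    exact Finset.sum_le_sum fun i _ => Int.le_self_sq _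
  have h2 : 0 ≤ ∑ i ∈ Finset.range m, (T (k + i + 1) - T (k + i)) ^ 2 :=
    Finset.sum_nonneg fun i _ => sq_nonneg _
  have h3 : T (k + m) - T (k + m + k) ≤
      ∑ i ∈ Finset.range k, (T (k + m + i + 1) - T (k + m + i)) ^ 2 := by
    have h := Finset.sum_range_sub' (fun i => T (k + m + i)) k
    rw [add_zero] at h
    rw [← h]
    refine Finset.sum_le_sum fun i _ => ?_
    rw [← add_assoc, ← neg_sq, neg_sub]
    exact Int.le_self_sq _
  linarith

/-- A long ear whose endpoints are joined by two further disjoint paths has large transmission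
energy. -/
lemma le_sum_sq_transmission_of_ear {V : Type*} [Fintype V] {G : SimpleGraph V}
    (hc : G.Connected) {w x : V} {P Q R : G.Walk w x} (hP : P.IsPath) (hE : IsEar P)
    (hQ : Q.IsPath) (hR : R.IsPath)
    (hPQ : ∀ v ∈ P.support, v ∈ Q.support → v = w ∨ v = x)
    (hPR : ∀ v ∈ P.support, v ∈ R.support → v = w ∨ v = x)
    (hQR : ∀ v ∈ Q.support, v ∈ R.support → v = w ∨ v = x)
    (hPL : 6 ≤ P.length) (hQL : 2 ≤ Q.length) (hRL : 2 ≤ R.length)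
    (hn : 29 ≤ Fintype.card V) :
    19 ≤ ∑ i ∈ Finset.range P.length,
      (transmission G (P.getVert (i + 1)) - transmission G (P.getVert i)) ^ 2 := by
  have hends := le_sum_range_sq_sub_of_ends (fun i => transmission G (P.getVert i))
    (L := P.length) (by omega)
  simp only [P.getVert_zero, P.getVert_length] at hends
  by_cases hD : P.length ≤ G.dist w x + 1
  · have := le_transmission_ends hc hP hE hQ hR hPQ hPR hQR (by omega) hD
    exact hends (by omega)
  have hcard := length_add_length_add_length_le hP hQ hR hPQ hPR hQR
  have hDQ : G.dist w x ≤ Q.length := G.dist_le Q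
  have hDR : G.dist w x ≤ R.length := G.dist_le R
  have hslope : ∀ k : ℕ, 2 * k + G.dist w x ≤ P.length →
      2 * ((k : ℤ) * (Fintype.card V - P.length - G.dist w x)) ≤
      (transmission G (P.getVert k) - transmission G w) +
        (transmission G (P.getVert (P.length - k)) - transmission G x) := by
    intro k hk
    have h1 := le_transmission_getVert_sub hc hP hE hk
    have h2 := le_transmission_getVert_sub hc hP.reverse hE.reverse (k := k)
      (by rw [P.length_reverse, G.dist_comm]; exact hk)
    rw [P.length_reverse, P.getVert_reverse, G.dist_comm] at h2
    linarith
  have hmid : ∀ k : ℕ, 2 * k ≤ P.length → _ := fun k hk =>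
    sub_add_sub_le_sum_range_sq_sub (fun i => transmission G (P.getVert i)) hk
  simp only [P.getVert_zero, P.getVert_length] at hmid
  by_cases h4 : P.length + G.dist w x + 4 ≤ Fintype.card V
  · have := hslope 1 (by omega)
    exact hends (by push_cast at this; omega)
  by_cases h2 : P.length + G.dist w x + 2 ≤ Fintype.card V
  · have h5 := hslope 5 (by omega)
    have h6 := hmid 5 (by omega)
    push_cast at h5
    omega
  · have h5 := hslope 10 (by omega)
    have h6 := hmid 10 (by omega)
    push_cast at h5
    omega

lemma sum_range_sq_transmission_le {V : Type*} [Fintype V] {G : SimpleGraph V} {w x : V}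
    {P : G.Walk w x} (hP : P.IsPath) :
    ∑ i ∈ Finset.range P.length,
      (transmission G (P.getVert (i + 1)) - transmission G (P.getVert i)) ^ 2 ≤
    ∑ e ∈ G.edgeFinset, transmissionDiffSq G e := by
  have hinj : Set.InjOn (fun i => s(P.getVert (i + 1), P.getVert i)) (Finset.range P.length) := by
    intro i hi j hj h
    simp only [Finset.coe_range, Set.mem_Iio] at hi hj
    rw [Sym2.eq_iff, getVert_eq_iff hP (by omega) (by omega),
      getVert_eq_iff hP (by omega) (by omega), getVert_eq_iff hP (by omega) (by omega),
      getVert_eq_iff hP (by omega) (by omega)] at h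
    omega
  have hsub : (Finset.range P.length).image (fun i => s(P.getVert (i + 1), P.getVert i)) ⊆
      G.edgeFinset := by
    intro e he
    simp only [Finset.mem_image, Finset.mem_range] at he
    obtain ⟨i, hi, rfl⟩ := he
    rw [SimpleGraph.mem_edgeFinset, SimpleGraph.mem_edgeSet]
    exact (P.adj_getVert_succ hi).symm
  refine le_trans ?_ (Finset.sum_le_sum_of_subset_of_nonneg hsub
    fun e _ _ => transmissionDiffSq_nonneg G e)
  rw [Finset.sum_image hinj]
  rfl

lemma IntDisj.symm {V : Type*} {G : SimpleGraph V} {x y x' y' : V} {P : G.Walk x y}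
    {Q : G.Walk x' y'} (h : IntDisj P Q) : IntDisj Q P :=
  fun v hQ hP => (h v hP hQ).symm

lemma intDisj_reverse_left {V : Type*} {G : SimpleGraph V} {x y x' y' : V} {P : G.Walk x y}
    {Q : G.Walk x' y'} : IntDisj P.reverse Q ↔ IntDisj P Q := by
  simp only [IntDisj, SimpleGraph.Walk.support_reverse, List.mem_reverse, or_comm]

lemma intDisj_reverse_right {V : Type*} {G : SimpleGraph V} {x y x' y' : V} {P : G.Walk x y}
    {Q : G.Walk x' y'} : IntDisj P Q.reverse ↔ IntDisj P Q := by
  simp only [IntDisj, SimpleGraph.Walk.support_reverse, List.mem_reverse, or_comm]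

lemma SimpleGraph.Walk.IsPath.append_of_disjoint {V : Type*} {G : SimpleGraph V} {u v w : V}
    {P : G.Walk u v} {Q : G.Walk v w} (hP : P.IsPath) (hQ : Q.IsPath)
    (h : ∀ t ∈ P.support, t ∈ Q.support → t = v) : (P.append Q).IsPath := by
  have hQn := hQ.support_nodup
  rw [← Q.cons_tail_support, List.nodup_cons] at hQn
  rw [SimpleGraph.Walk.isPath_def, SimpleGraph.Walk.support_append, List.nodup_append]
  refine ⟨hP.support_nodup, hQn.2, fun a ha b hb hab => ?_⟩
  subst hab
  exact hQn.1 (h a ha (List.mem_of_mem_tail hb) ▸ hb)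

/-- In a subdivision of `K₄`, a long path between two branch vertices forces a large
transmission energy. -/
lemma le_sum_transmissionDiffSq {V : Type*} [Fintype V] {G : SimpleGraph V}
    (hc : G.Connected) {a b c d : V} (Pab : G.Walk a b) (Pac : G.Walk a c) (Pad : G.Walk a d)
    (Pbc : G.Walk b c) (Pbd : G.Walk b d) (Pcd : G.Walk c d)
    (hab : a ≠ b) (hac : a ≠ c) (had : a ≠ d) (hbc : b ≠ c) (hbd : b ≠ d) (hcd : c ≠ d)
    (pab : Pab.IsPath) (pac : Pac.IsPath) (pad : Pad.IsPath) (pbc : Pbc.IsPath)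
    (pbd : Pbd.IsPath)
    (h1 : IntDisj Pab Pac) (h2 : IntDisj Pab Pad) (h3 : IntDisj Pab Pbc) (h4 : IntDisj Pab Pbd)
    (h5 : IntDisj Pab Pcd) (h6 : IntDisj Pac Pad) (h7 : IntDisj Pac Pbc) (h8 : IntDisj Pac Pbd)
    (h9 : IntDisj Pad Pbc) (h10 : IntDisj Pad Pbd) (h11 : IntDisj Pbc Pbd)
    (hedge : ∀ e ∈ G.edgeSet, e ∈ Pab.edges ∨ e ∈ Pac.edges ∨ e ∈ Pad.edges ∨
      e ∈ Pbc.edges ∨ e ∈ Pbd.edges ∨ e ∈ Pcd.edges)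
    (hL : 6 ≤ Pab.length) (hn : 29 ≤ Fintype.card V) :
    19 ≤ ∑ e ∈ G.edgeFinset, transmissionDiffSq G e := by
  have hpos : ∀ {u v : V} (P : G.Walk u v), u ≠ v → 1 ≤ P.length := fun P huv =>
    Nat.one_le_iff_ne_zero.2 fun h => huv (P.eq_of_length_eq_zero h)
  have hear : IsEar Pab := by
    have hend : ∀ {p q u v : V} {S : G.Walk p q}, IntDisj Pab S → s(u, v) ∈ S.edges →
        ∀ t ∈ Pab.support, t = u ∨ t = v → t = a ∨ t = b := by
      rintro p q u v S hS he t ht (rfl | rfl)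
      · exact (hS t ht (S.fst_mem_support_of_mem_edges he)).1
      · exact (hS t ht (S.snd_mem_support_of_mem_edges he)).1
    intro u v huv
    rcases hedge _ (G.mem_edgeSet.2 huv) with h | h | h | h | h | h
    · exact Or.inl h
    · exact Or.inr (hend h1 h)
    · exact Or.inr (hend h2 h)
    · exact Or.inr (hend h3 h)
    · exact Or.inr (hend h4 h)
    · exact Or.inr (hend h5 h)
  have hQ : (Pac.append Pbc.reverse).IsPath := pac.append_of_disjoint pbc.reverse (by
    intro t ht ht'
    rw [SimpleGraph.Walk.support_reverse, List.mem_reverse] at ht'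
    have := h7 t ht ht'
    grind)
  have hR : (Pad.append Pbd.reverse).IsPath := pad.append_of_disjoint pbd.reverse (by
    intro t ht ht'
    rw [SimpleGraph.Walk.support_reverse, List.mem_reverse] at ht'
    have := h10 t ht ht'
    grind)
  refine (le_sum_sq_transmission_of_ear hc pab hear hQ hR ?_ ?_ ?_ hL ?_ ?_ hn).trans
    (sum_range_sq_transmission_le pab)
  · intro v hv hv'
    rw [SimpleGraph.Walk.mem_support_append_iff, SimpleGraph.Walk.support_reverse,
      List.mem_reverse] at hv'
    exact hv'.elim (fun h => (h1 v hv h).1) fun h => (h3 v hv h).1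
  · intro v hv hv'
    rw [SimpleGraph.Walk.mem_support_append_iff, SimpleGraph.Walk.support_reverse,
      List.mem_reverse] at hv'
    exact hv'.elim (fun h => (h2 v hv h).1) fun h => (h4 v hv h).1
  · intro v hv hv'
    rw [SimpleGraph.Walk.mem_support_append_iff, SimpleGraph.Walk.support_reverse,
      List.mem_reverse] at hv hv'
    rcases hv with hv | hv <;> rcases hv' with hv' | hv'
    · have := h6 v hv hv'
      grind
    · have := h8 v hv hv'
      grind
    · have := h9 v hv' hv
      grind
    · have := h11 v hv hv'
      grind
  · have := hpos Pac hac
    have := hpos Pbc hbc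
    rw [SimpleGraph.Walk.length_append, SimpleGraph.Walk.length_reverse]
    omega
  · have := hpos Pad had
    have := hpos Pbd hbd
    rw [SimpleGraph.Walk.length_append, SimpleGraph.Walk.length_reverse]
    omega

/-- The internal vertices of a walk. -/
noncomputable def innerVerts {V : Type*} {G : SimpleGraph V} {a b : V} (P : G.Walk a b) :
    Finset V :=
  P.support.toFinset \ {a, b}

lemma mem_innerVerts {V : Type*} {G : SimpleGraph V} {a b v : V} {P : G.Walk a b} :
    v ∈ innerVerts P ↔ v ∈ P.support ∧ v ≠ a ∧ v ≠ b := by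
  simp [innerVerts]

lemma card_innerVerts {V : Type*} {G : SimpleGraph V} {a b : V} {P : G.Walk a b}
    (hP : P.IsPath) (hab : a ≠ b) : (innerVerts P).card + 1 = P.length := by
  have hsub : ({a, b} : Finset V) ⊆ P.support.toFinset := by
    intro v hv
    simp only [Finset.mem_insert, Finset.mem_singleton] at hv
    rcases hv with rfl | rfl <;> simp
  have h := Finset.card_sdiff_add_card_eq_card hsub
  rw [Finset.card_pair hab, List.toFinset_card_of_nodup hP.support_nodup, P.length_support] at h
  unfold innerVerts
  omega

lemma IntDisj.disjoint_innerVerts {V : Type*} {G : SimpleGraph V} {x y x' y' : V}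
    {P : G.Walk x y} {Q : G.Walk x' y'} (h : IntDisj P Q) :
    Disjoint (innerVerts P) (innerVerts Q) := by
  rw [Finset.disjoint_left]
  intro v hv hv'
  rw [mem_innerVerts] at hv hv'
  have := h v hv.1 hv'.1
  tauto

lemma IntDisj.notMem_innerVerts {V : Type*} {G : SimpleGraph V} {x y x' y' v : V}
    {P : G.Walk x y} {Q : G.Walk x' y'} (h : IntDisj P Q) (hv : v ∈ Q.support) :
    v ∉ innerVerts P := by
  intro hv'
  rw [mem_innerVerts] at hv'
  have := (h v hv'.1 hv).1
  tauto


lemma start_notMem_innerVerts {V : Type*} {G : SimpleGraph V} {a b : V} (P : G.Walk a b) :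
    a ∉ innerVerts P := by
  simp [mem_innerVerts]

lemma end_notMem_innerVerts {V : Type*} {G : SimpleGraph V} {a b : V} (P : G.Walk a b) :
    b ∉ innerVerts P := by
  simp [mem_innerVerts]

/-- The total length of the six paths of a subdivision of `K₄` on `n` vertices is `n + 2`. -/
lemma card_add_two_eq_sum_length {V : Type*} [Fintype V] {G : SimpleGraph V} {w x y z : V}
    {Pwx : G.Walk w x} {Pwy : G.Walk w y} {Pwz : G.Walk w z}
    {Pxy : G.Walk x y} {Pxz : G.Walk x z} {Pyz : G.Walk y z}
    (hwx : w ≠ x) (hwy : w ≠ y) (hwz : w ≠ z) (hxy : x ≠ y) (hxz : x ≠ z) (hyz : y ≠ z)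
    (pwx : Pwx.IsPath) (pwy : Pwy.IsPath) (pwz : Pwz.IsPath)
    (pxy : Pxy.IsPath) (pxz : Pxz.IsPath) (pyz : Pyz.IsPath)
    (h1 : IntDisj Pwx Pwy) (h2 : IntDisj Pwx Pwz) (h3 : IntDisj Pwx Pxy) (h4 : IntDisj Pwx Pxz)
    (h5 : IntDisj Pwx Pyz) (h6 : IntDisj Pwy Pwz) (h7 : IntDisj Pwy Pxy) (h8 : IntDisj Pwy Pxz)
    (h9 : IntDisj Pwy Pyz) (h10 : IntDisj Pwz Pxy) (h11 : IntDisj Pwz Pxz)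
    (h12 : IntDisj Pwz Pyz) (h13 : IntDisj Pxy Pxz) (h14 : IntDisj Pxy Pyz)
    (h15 : IntDisj Pxz Pyz)
    (hcover : ∀ v : V, v ∈ Pwx.support ∨ v ∈ Pwy.support ∨ v ∈ Pwz.support ∨
      v ∈ Pxy.support ∨ v ∈ Pxz.support ∨ v ∈ Pyz.support) :
    Fintype.card V + 2 = Pwx.length + Pwy.length + Pwz.length + Pxy.length +
      Pxz.length + Pyz.length := by
  have hB : ({w, x, y, z} : Finset V).card = 4 := by
    rw [Finset.card_insert_of_notMem, Finset.card_insert_of_notMem, Finset.card_pair hyz]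
    · simp [hxy, hxz]
    · simp [hwx, hwy, hwz]
  have huniv : (Finset.univ : Finset V) = {w, x, y, z} ∪ (innerVerts Pwx ∪ (innerVerts Pwy ∪
      (innerVerts Pwz ∪ (innerVerts Pxy ∪ (innerVerts Pxz ∪ innerVerts Pyz))))) := by
    ext v
    simp only [Finset.mem_univ, Finset.mem_union, mem_innerVerts, Finset.mem_insert,
      Finset.mem_singleton, true_iff]
    by_cases hv : v = w ∨ v = x ∨ v = y ∨ v = z
    · exact Or.inl hv
    · simp only [not_or] at hv
      simpa [hv] using hcover v
  have hBd : Disjoint ({w, x, y, z} : Finset V) (innerVerts Pwx ∪ (innerVerts Pwy ∪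
      (innerVerts Pwz ∪ (innerVerts Pxy ∪ (innerVerts Pxz ∪ innerVerts Pyz))))) := by
    simp only [Finset.disjoint_insert_left, Finset.disjoint_singleton_left, Finset.mem_union,
      not_or, start_notMem_innerVerts, end_notMem_innerVerts, not_false_eq_true, and_true,
      h3.symm.notMem_innerVerts Pwx.start_mem_support,
      h4.symm.notMem_innerVerts Pwx.start_mem_support,
      h5.symm.notMem_innerVerts Pwx.start_mem_support,
      h1.symm.notMem_innerVerts Pwx.end_mem_support,
      h2.symm.notMem_innerVerts Pwx.end_mem_support,
      h5.symm.notMem_innerVerts Pwx.end_mem_support,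
      h1.notMem_innerVerts Pwy.end_mem_support,
      h6.symm.notMem_innerVerts Pwy.end_mem_support,
      h8.symm.notMem_innerVerts Pwy.end_mem_support,
      h2.notMem_innerVerts Pwz.end_mem_support,
      h6.notMem_innerVerts Pwz.end_mem_support,
      h10.symm.notMem_innerVerts Pwz.end_mem_support]
  have d1 := h1.disjoint_innerVerts
  have d2 := h2.disjoint_innerVerts
  have d3 := h3.disjoint_innerVerts
  have d4 := h4.disjoint_innerVerts
  have d5 := h5.disjoint_innerVerts
  have d6 := h6.disjoint_innerVerts
  have d7 := h7.disjoint_innerVerts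
  have d8 := h8.disjoint_innerVerts
  have d9 := h9.disjoint_innerVerts
  have d10 := h10.disjoint_innerVerts
  have d11 := h11.disjoint_innerVerts
  have d12 := h12.disjoint_innerVerts
  have d13 := h13.disjoint_innerVerts
  have d14 := h14.disjoint_innerVerts
  rw [← Finset.card_univ, huniv, Finset.card_union_of_disjoint hBd,
    Finset.card_union_of_disjoint
      (by simp only [Finset.disjoint_union_right]; exact ⟨d1, d2, d3, d4, d5⟩),
    Finset.card_union_of_disjoint
      (by simp only [Finset.disjoint_union_right]; exact ⟨d6, d7, d8, d9⟩),
    Finset.card_union_of_disjoint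
      (by simp only [Finset.disjoint_union_right]; exact ⟨d10, d11, d12⟩),
    Finset.card_union_of_disjoint
      (by simp only [Finset.disjoint_union_right]; exact ⟨d13, d14⟩),
    Finset.card_union_of_disjoint h15.disjoint_innerVerts, hB]
  have := card_innerVerts pwx hwx
  have := card_innerVerts pwy hwy
  have := card_innerVerts pwz hwz
  have := card_innerVerts pxy hxy
  have := card_innerVerts pxz hxz
  have := card_innerVerts pyz hyz
  omega

/-- A Θ₄-graph (subdivision of `K₄`) of order `n ≥ 29` has revised Szeged index
less than `(n³ + 2n² − 18)/4`. -/
theorem revSz_lt_of_isTheta4 {V : Type*} [Fintype V] (G : SimpleGraph V)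
    (hΘ : IsTheta4 G) (hn : 29 ≤ Fintype.card V) :
    revSz G < ((Fintype.card V : ℚ) ^ 3 + 2 * (Fintype.card V : ℚ) ^ 2 - 18) / 4 := by
  obtain ⟨w, x, y, z, Pwx, Pwy, Pwz, Pxy, Pxz, Pyz, hwx, hwy, hwz, hxy, hxz, hyz,
    pwx, pwy, pwz, pxy, pxz, pyz, h1, h2, h3, h4, h5, h6, h7, h8, h9, h10, h11, h12, h13, h14, h15,
    hcover, hedge⟩ := hΘ
  have hc : G.Connected := by
    refine (SimpleGraph.connected_iff_exists_forall_reachable G).2 ⟨w, fun v => ?_⟩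
    rcases hcover v with h | h | h | h | h | h
    · exact ⟨Pwx.takeUntil v h⟩
    · exact ⟨Pwy.takeUntil v h⟩
    · exact ⟨Pwz.takeUntil v h⟩
    · exact ⟨Pwx.append (Pxy.takeUntil v h)⟩
    · exact ⟨Pwx.append (Pxz.takeUntil v h)⟩
    · exact ⟨Pwy.append (Pyz.takeUntil v h)⟩
  have hcardV := card_add_two_eq_sum_length hwx hwy hwz hxy hxz hyz pwx pwy pwz pxy pxz pyz
    h1 h2 h3 h4 h5 h6 h7 h8 h9 h10 h11 h12 h13 h14 h15 hcover
  have hcardE : G.edgeFinset.card ≤ Fintype.card V + 2 := by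
    have hsub : G.edgeFinset ⊆ (Pwx.edges ++ Pwy.edges ++ Pwz.edges ++ Pxy.edges ++ Pxz.edges ++
        Pyz.edges).toFinset := by
      intro e he
      simpa [or_assoc] using hedge e (SimpleGraph.mem_edgeFinset.1 he)
    refine (Finset.card_le_card hsub).trans ((List.toFinset_card_le _).trans ?_)
    simp only [List.length_append, SimpleGraph.Walk.length_edges]
    omega
  have henergy : 19 ≤ ∑ e ∈ G.edgeFinset, transmissionDiffSq G e := by
    have hlong : 6 ≤ Pwx.length ∨ 6 ≤ Pwy.length ∨ 6 ≤ Pwz.length ∨ 6 ≤ Pxy.length ∨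
        6 ≤ Pxz.length ∨ 6 ≤ Pyz.length := by omega
    rcases hlong with hL | hL | hL | hL | hL | hL <;>
      [apply le_sum_transmissionDiffSq hc Pwx Pwy Pwz Pxy Pxz Pyz
        (hL := hL) (hn := hn);
      apply le_sum_transmissionDiffSq hc Pwy Pwx Pwz Pxy.reverse Pyz Pxz
        (hL := hL) (hn := hn);
      apply le_sum_transmissionDiffSq hc Pwz Pwx Pwy Pxz.reverse Pyz.reverse Pxy
        (hL := hL) (hn := hn);
      apply le_sum_transmissionDiffSq hc Pxy Pwx.reverse Pxz Pwy.reverse Pyz Pwz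
        (hL := hL) (hn := hn);
      apply le_sum_transmissionDiffSq hc Pxz Pwx.reverse Pxy Pwz.reverse Pyz.reverse Pwy
        (hL := hL) (hn := hn);
      apply le_sum_transmissionDiffSq hc Pyz Pwy.reverse Pxy.reverse Pwz.reverse Pxz.reverse Pwx
        (hL := hL) (hn := hn)]
    all_goals
      try simp only [intDisj_reverse_left, intDisj_reverse_right,
        SimpleGraph.Walk.isPath_reverse_iff, SimpleGraph.Walk.edges_reverse, List.mem_reverse]
      first
      | assumption
      | exact Ne.symm (by assumption)
      | exact IntDisj.symm (by assumption)
      | exact fun e he => by have := hedge e he; tauto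
  rw [revSz_eq]
  have hE : (G.edgeFinset.card : ℚ) ≤ Fintype.card V + 2 := by exact_mod_cast hcardE
  have hT : (19 : ℚ) ≤ (∑ e ∈ G.edgeFinset, transmissionDiffSq G e : ℤ) := by
    exact_mod_cast henergy
  have := mul_le_mul_of_nonneg_right hE (sq_nonneg (Fintype.card V : ℚ))
  linarith
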